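/- Let α, β, γ > −1 and n ≥ 1. Each of the three bivariate polynomials (x,y) ↦ P_n^{(α, β+γ+1)}(1−2x), (x,y) ↦ P_n^{(β, α+γ+1)}(1−2y), and (x,y) ↦ P_n^{(γ, α+β+1)}(2(x+y)−1) is orthogonal to every bivariate polynomial of total degree ≤ n−1 with respect to the inner product of L²(T_1, x^α y^β (1−x−y)^γ dx dy); i.e., each lies in the orthogonal complement of P_{n−1}(T_1) in P_n(T_1) for this inner product. -/

import Mathlib

open MeasureTheory Finset

noncomputable section

/-- Shifted factorial (Pochhammer symbol) `(a)_k = a (a+1) ⋯ (a+k-1)`. -/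
def poch (a : ℝ) (k : ℕ) : ℝ := ∏ j ∈ Finset.range k, (a + j)

/-- The Jacobi polynomial `P_n^{(a,b)}` as a univariate real polynomial,
`P_n^{(a,b)}(x) = ((a+1)_n/n!) Σ_{k=0}^n ((-n)_k (n+a+b+1)_k)/((a+1)_k k!) ((1-x)/2)^k`. -/
def jacobiPoly (n : ℕ) (a b : ℝ) : Polynomial ℝ :=
  Polynomial.C (poch (a + 1) n / (n.factorial : ℝ)) *
    ∑ k ∈ Finset.range (n + 1),
      Polynomial.C (poch (-(n : ℝ)) k * poch ((n : ℝ) + a + b + 1) k /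
          (poch (a + 1) k * (k.factorial : ℝ))) *
        (Polynomial.C (2⁻¹ : ℝ) * (1 - Polynomial.X)) ^ k

/-- The value `P_n^{(a,b)}(x)` of the Jacobi polynomial. -/
def jacobiR (n : ℕ) (a b x : ℝ) : ℝ := (jacobiPoly n a b).eval x

/-- Substitute a bivariate polynomial into a univariate polynomial. -/
def substX (f : Polynomial ℝ) (g : MvPolynomial (Fin 2) ℝ) : MvPolynomial (Fin 2) ℝ :=
  Polynomial.aeval g f

/-- The open unit triangle `T₁ = {(x,y) : x > 0, y > 0, 1 - x - y > 0}`. -/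
def T1 : Set (ℝ × ℝ) := {p : ℝ × ℝ | 0 < p.1 ∧ 0 < p.2 ∧ 0 < 1 - p.1 - p.2}

/-- Evaluation of a bivariate polynomial at a point of `ℝ²`. -/
def evalP (u : MvPolynomial (Fin 2) ℝ) (p : ℝ × ℝ) : ℝ :=
  MvPolynomial.eval ![p.1, p.2] u

/-- The hypergeometric coefficient of `((1 - x) / 2) ^ k` in `jacobiPoly n a b`, up to the
prefactor `(a + 1)_n / n!`. -/
def jacobiCoeff (n : ℕ) (a b : ℝ) (k : ℕ) : ℝ :=
  poch (-(n : ℝ)) k * poch ((n : ℝ) + a + b + 1) k / (poch (a + 1) k * (k.factorial : ℝ))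

lemma jacobiPoly_natDegree_le (n : ℕ) (a b : ℝ) : (jacobiPoly n a b).natDegree ≤ n := by
  unfold jacobiPoly
  refine (Polynomial.natDegree_C_mul_le _ _).trans
    (Polynomial.natDegree_sum_le_of_forall_le _ _ fun k hk => ?_)
  refine (Polynomial.natDegree_C_mul_le _ _).trans (Polynomial.natDegree_pow_le.trans ?_)
  have h : (Polynomial.C (2⁻¹ : ℝ) * (1 - Polynomial.X)).natDegree ≤ 1 := by
    refine (Polynomial.natDegree_C_mul_le _ _).trans ?_
    compute_degree
  have hk' : k ≤ n := Nat.lt_succ_iff.mp (Finset.mem_range.mp hk)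
  nlinarith

lemma jacobiR_one_sub_two_mul (n : ℕ) (a b x : ℝ) :
    jacobiR n a b (1 - 2 * x) =
      poch (a + 1) n / n.factorial * ∑ k ∈ range (n + 1), jacobiCoeff n a b k * x ^ k := by
  simp [jacobiR, jacobiPoly, jacobiCoeff, Polynomial.eval_finsetSum]

lemma poch_pos {a : ℝ} (ha : 0 < a) (k : ℕ) : 0 < poch a k :=
  Finset.prod_pos fun _ _ => by positivity

lemma Gamma_add_nat_eq_poch_mul {a : ℝ} (ha : 0 < a) (m : ℕ) :
    Real.Gamma (a + m) = poch a m * Real.Gamma a := by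
  induction m with
  | zero => simp [poch]
  | succ m ih =>
    have h : a + (m : ℝ) ≠ 0 := by positivity
    rw [Nat.cast_succ, ← add_assoc, Real.Gamma_add_one h, ih, poch, poch, Finset.prod_range_succ]
    ring

lemma poch_neg_natCast_div_factorial {n k : ℕ} (hk : k ≤ n) :
    poch (-(n : ℝ)) k / k.factorial = (-1) ^ k * n.choose k := by
  have h : poch (-(n : ℝ)) k = (-1) ^ k * (n.descFactorial k : ℝ) := by
    induction k with
    | zero => simp [poch]
    | succ k ih =>
      have ih' := ih (by omega)
      rw [poch] at ih'
      rw [poch, Finset.prod_range_succ, ih', Nat.descFactorial_succ, Nat.cast_mul,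
        Nat.cast_sub (by omega)]
      ring
  rw [h, Nat.descFactorial_eq_factorial_mul_choose, Nat.cast_mul]
  have := Nat.factorial_ne_zero k
  field_simp

/-- The polynomial `x ↦ (c + x)_m`. -/
def pochPoly (c : ℝ) (m : ℕ) : Polynomial ℝ :=
  ∏ j ∈ range m, (Polynomial.X + Polynomial.C (c + j))

lemma pochPoly_eval (c x : ℝ) (m : ℕ) : (pochPoly c m).eval x = poch (c + x) m := by
  simp only [pochPoly, poch, Polynomial.eval_prod]
  refine Finset.prod_congr rfl fun j _ => ?_
  simp
  ring

lemma pochPoly_natDegree_le (c : ℝ) (m : ℕ) : (pochPoly c m).natDegree ≤ m := by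
  refine (Polynomial.natDegree_prod_le _ _).trans ?_
  simp only [Polynomial.natDegree_X_add_C, sum_const, card_range, smul_eq_mul, mul_one, le_refl]

lemma sum_neg_one_pow_mul_choose_mul_eval {n : ℕ} {P : Polynomial ℝ} (hP : P.natDegree < n) :
    ∑ k ∈ range (n + 1), (-1 : ℝ) ^ k * n.choose k * P.eval (k : ℝ) = 0 := by
  have h := congrFun (Polynomial.fwdDiff_iter_eq_zero_of_degree_lt hP) 0
  rw [fwdDiff_iter_eq_sum_shift] at h
  have h2 : ∑ k ∈ range (n + 1), (-1 : ℝ) ^ k * n.choose k * P.eval (k : ℝ) =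
      (-1) ^ n * ∑ k ∈ range (n + 1),
        ((-1 : ℤ) ^ (n - k) * n.choose k) • P.eval (0 + k • (1 : ℝ)) := by
    rw [Finset.mul_sum]
    refine Finset.sum_congr rfl fun k hk => ?_
    obtain ⟨d, rfl⟩ := Nat.exists_eq_add_of_le (Nat.lt_succ_iff.mp (Finset.mem_range.mp hk))
    have h1 : ((-1 : ℝ) ^ d) * (-1) ^ d = 1 := by rw [← mul_pow]; simp
    simp only [zsmul_eq_mul, add_tsub_cancel_left]
    push_cast
    simp only [nsmul_eq_mul, mul_one, zero_add, pow_add]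
    linear_combination (-(-1 : ℝ) ^ k * ((k + d).choose k) * P.eval (k : ℝ)) * h1
  rw [h2, h]
  simp

/-- The hypergeometric summation behind the orthogonality relations. -/
lemma sum_jacobiCoeff_mul_Gamma_div_Gamma {n i l : ℕ} {p B : ℝ} (hp : -1 < p) (hB : -1 < B)
    (hil : i + l < n) :
    ∑ k ∈ range (n + 1), jacobiCoeff n p B k *
      (Real.Gamma (p + 1 + k + i) / Real.Gamma (p + B + i + l + 2 + k)) = 0 := by
  obtain ⟨d, rfl⟩ := Nat.exists_eq_add_of_lt hil
  set n := i + l + d + 1 with hn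
  have hnR : (n : ℝ) = i + l + d + 1 := by rw [hn]; push_cast; ring
  have hi : (0 : ℝ) ≤ i := by positivity
  have hl : (0 : ℝ) ≤ l := by positivity
  have hd : (0 : ℝ) ≤ d := by positivity
  let P : Polynomial ℝ := pochPoly (p + B + i + l + 2) d * pochPoly (p + 1) i
  have hP : P.natDegree < n := by
    have h1 := Polynomial.natDegree_mul_le (p := pochPoly (p + B + i + l + 2) d)
      (q := pochPoly (p + 1) i)
    have h2 := pochPoly_natDegree_le (p + B + i + l + 2) d
    have h3 := pochPoly_natDegree_le (p + 1) i
    change (_ * _ : Polynomial ℝ).natDegree < n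
    omega
  have key : ∀ k ∈ range (n + 1), jacobiCoeff n p B k *
      (Real.Gamma (p + 1 + k + i) / Real.Gamma (p + B + i + l + 2 + k)) =
      (Real.Gamma (p + 1) / Real.Gamma (n + p + B + 1)) *
        ((-1 : ℝ) ^ k * n.choose k * P.eval (k : ℝ)) := by
    intro k hk
    have hk' : k ≤ n := Nat.lt_succ_iff.mp (Finset.mem_range.mp hk)
    have hk0 : (0 : ℝ) ≤ k := by positivity
    have e0 := poch_neg_natCast_div_factorial hk'
    have pos1 : 0 < p + 1 := by linarith
    have pos2 : 0 < (n : ℝ) + p + B + 1 := by linarith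
    have pos3 : 0 < p + B + i + l + 2 + k := by linarith
    have e1 := Gamma_add_nat_eq_poch_mul pos1 k
    have e2 := Gamma_add_nat_eq_poch_mul pos2 k
    have e3 := Gamma_add_nat_eq_poch_mul (a := p + 1 + k) (by linarith) i
    have e4 := Gamma_add_nat_eq_poch_mul pos3 d
    have e5 : p + B + i + l + 2 + k + d = (n : ℝ) + p + B + 1 + k := by rw [hnR]; ring
    rw [e5, e2] at e4
    have g1 := (Real.Gamma_pos_of_pos pos1).ne'
    have g2 := (Real.Gamma_pos_of_pos pos2).ne'
    have g3 := (Real.Gamma_pos_of_pos pos3).ne'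
    have q1 := (poch_pos pos1 k).ne'
    have hf : (k.factorial : ℝ) ≠ 0 := by positivity
    rw [← e0, e3, e1]
    simp only [P, Polynomial.eval_mul, pochPoly_eval, jacobiCoeff]
    rw [eq_div_of_mul_eq g2 e4]
    field_simp
  rw [Finset.sum_congr rfl key, ← Finset.mul_sum, sum_neg_one_pow_mul_choose_mul_eval hP, mul_zero]

/-- The Euler beta integral over `(0, c)`. -/
lemma setIntegral_rpow_mul_sub_rpow {p q c : ℝ} (hp : -1 < p) (hq : -1 < q) (hc : 0 < c) :
    ∫ y in Set.Ioo 0 c, y ^ p * (c - y) ^ q =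
      c ^ (p + q + 1) * ProbabilityTheory.beta (p + 1) (q + 1) := by
  have h := Complex.betaIntegral_scaled ((p + 1 : ℝ) : ℂ) ((q + 1 : ℝ) : ℂ) hc
  rw [intervalIntegral.integral_of_le hc.le, integral_Ioc_eq_integral_Ioo] at h
  have h1 : ∫ y in Set.Ioo 0 c, (y : ℂ) ^ (((p + 1 : ℝ) : ℂ) - 1) *
      ((c : ℂ) - y) ^ (((q + 1 : ℝ) : ℂ) - 1) =
      ∫ y in Set.Ioo 0 c, ((y ^ p * (c - y) ^ q : ℝ) : ℂ) := by
    refine setIntegral_congr_fun measurableSet_Ioo fun y hy => ?_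
    rw [Complex.ofReal_mul, Complex.ofReal_cpow hy.1.le, Complex.ofReal_cpow (by linarith [hy.2])]
    push_cast
    simp
  rw [h1, integral_complex_ofReal] at h
  rw [ProbabilityTheory.beta_eq_betaIntegralReal _ _ (by linarith) (by linarith)]
  have h2 := congrArg Complex.re h
  have h3 : ((p + 1 : ℝ) : ℂ) + ((q + 1 : ℝ) : ℂ) - 1 = ((p + q + 1 : ℝ) : ℂ) := by
    push_cast; ring
  rw [h3, ← Complex.ofReal_cpow hc.le, Complex.re_ofReal_mul, Complex.ofReal_re] at h2
  exact h2

lemma integrableOn_rpow_mul_sub_rpow {p q c : ℝ} (hp : -1 < p) (hq : -1 < q) (hc : 0 < c) :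
    IntegrableOn (fun y => y ^ p * (c - y) ^ q) (Set.Ioo 0 c) := by
  by_contra h
  have h1 := setIntegral_rpow_mul_sub_rpow hp hq hc
  rw [integral_undef h] at h1
  have h2 := ProbabilityTheory.beta_pos (α := p + 1) (β := q + 1) (by linarith) (by linarith)
  have h3 := Real.rpow_pos_of_pos hc (p + q + 1)
  exact (mul_pos h3 h2).ne h1

lemma measurableSet_T1 : MeasurableSet T1 := by
  have h : Measurable fun p : ℝ × ℝ => 1 - p.1 - p.2 := by fun_prop
  exact (measurableSet_lt measurable_const measurable_fst).inter
    ((measurableSet_lt measurable_const measurable_snd).inter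
      (measurableSet_lt measurable_const h))

/-- The density of the Dirichlet integral over the triangle. -/
def dirichletFun (p q r : ℝ) (x : ℝ × ℝ) : ℝ := x.1 ^ p * x.2 ^ q * (1 - x.1 - x.2) ^ r

lemma measurable_dirichletFun (p q r : ℝ) : Measurable (dirichletFun p q r) := by
  unfold dirichletFun
  fun_prop

lemma indicator_T1_dirichletFun (p q r x y : ℝ) :
    T1.indicator (dirichletFun p q r) (x, y) =
      (Set.Ioo (0 : ℝ) 1).indicator (fun x => x ^ p *
        (Set.Ioo 0 (1 - x)).indicator (fun y => y ^ q * (1 - x - y) ^ r) y) x := by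
  by_cases hx : x ∈ Set.Ioo (0 : ℝ) 1
  · by_cases hy : y ∈ Set.Ioo 0 (1 - x)
    · have h : (x, y) ∈ T1 := ⟨hx.1, hy.1, by linarith [hy.2]⟩
      simp only [Set.indicator_of_mem h, Set.indicator_of_mem hx, Set.indicator_of_mem hy,
        dirichletFun, mul_assoc]
    · have h : (x, y) ∉ T1 := fun h => hy ⟨h.2.1, by linarith [h.2.2]⟩
      rw [Set.indicator_of_notMem h, Set.indicator_of_mem hx, Set.indicator_of_notMem hy, mul_zero]
  · have h : (x, y) ∉ T1 := fun h => hx ⟨h.1, by linarith [h.2.1, h.2.2]⟩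
    simp [Set.indicator_of_notMem h, Set.indicator_of_notMem hx]

lemma indicator_T1_dirichletFun_nonneg (p q r : ℝ) (x : ℝ × ℝ) :
    0 ≤ T1.indicator (dirichletFun p q r) x := by
  refine Set.indicator_nonneg (fun x hx => ?_) x
  exact mul_nonneg (mul_nonneg (Real.rpow_nonneg hx.1.le _) (Real.rpow_nonneg hx.2.1.le _))
    (Real.rpow_nonneg hx.2.2.le _)

lemma integral_indicator_T1_dirichletFun_section {q r : ℝ} (p : ℝ) (hq : -1 < q) (hr : -1 < r)
    (x : ℝ) :
    ∫ y, T1.indicator (dirichletFun p q r) (x, y) =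
      (Set.Ioo (0 : ℝ) 1).indicator (fun x => x ^ p * (1 - x) ^ (q + r + 1)) x *
        ProbabilityTheory.beta (q + 1) (r + 1) := by
  simp only [indicator_T1_dirichletFun]
  by_cases hx : x ∈ Set.Ioo (0 : ℝ) 1
  · simp only [Set.indicator_of_mem hx]
    rw [integral_const_mul, integral_indicator measurableSet_Ioo,
      setIntegral_rpow_mul_sub_rpow hq hr (by linarith [hx.2]), mul_assoc]
  · simp [Set.indicator_of_notMem hx]

lemma integrable_indicator_T1_dirichletFun {p q r : ℝ} (hp : -1 < p) (hq : -1 < q) (hr : -1 < r) :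
    Integrable (T1.indicator (dirichletFun p q r)) := by
  have hm : AEStronglyMeasurable (T1.indicator (dirichletFun p q r))
      ((volume : Measure ℝ).prod volume) :=
    ((measurable_dirichletFun p q r).indicator measurableSet_T1).aestronglyMeasurable
  refine (integrable_prod_iff hm).mpr ⟨Filter.Eventually.of_forall fun x => ?_, ?_⟩
  · simp only [indicator_T1_dirichletFun]
    by_cases hx : x ∈ Set.Ioo (0 : ℝ) 1
    · simp only [Set.indicator_of_mem hx]
      exact ((integrable_indicator_iff measurableSet_Ioo).mpr
        (integrableOn_rpow_mul_sub_rpow hq hr (by linarith [hx.2]))).const_mul _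
    · simp [Set.indicator_of_notMem hx]
  · simp only [Real.norm_of_nonneg (indicator_T1_dirichletFun_nonneg _ _ _ _),
      integral_indicator_T1_dirichletFun_section p hq hr]
    exact ((integrable_indicator_iff measurableSet_Ioo).mpr
      (integrableOn_rpow_mul_sub_rpow hp (by linarith) one_pos)).mul_const _

/-- The Dirichlet integral over the triangle. -/
lemma setIntegral_T1_dirichletFun {p q r : ℝ} (hp : -1 < p) (hq : -1 < q) (hr : -1 < r) :
    ∫ x in T1, dirichletFun p q r x =
      Real.Gamma (p + 1) * Real.Gamma (q + 1) * Real.Gamma (r + 1) /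
        Real.Gamma (p + q + r + 3) := by
  have h1 := integral_prod (μ := (volume : Measure ℝ)) (ν := (volume : Measure ℝ)) _
    (integrable_indicator_T1_dirichletFun hp hq hr)
  rw [← integral_indicator measurableSet_T1]
  refine h1.trans ?_
  simp only [integral_indicator_T1_dirichletFun_section p hq hr]
  rw [integral_mul_const, integral_indicator measurableSet_Ioo,
    setIntegral_rpow_mul_sub_rpow hp (by linarith) one_pos, Real.one_rpow, one_mul]
  have e1 : q + r + 1 + 1 = q + 1 + (r + 1) := by ring
  have e2 : p + 1 + (q + 1 + (r + 1)) = p + q + r + 3 := by ring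
  have g1 := (Real.Gamma_pos_of_pos (s := q + 1 + (r + 1)) (by linarith)).ne'
  rw [ProbabilityTheory.beta, ProbabilityTheory.beta, e1, e2]
  field_simp

lemma dirichletFun_add_nat {p : ℝ × ℝ} (hp : p ∈ T1) (a b g : ℝ) (i j k : ℕ) :
    dirichletFun (a + i) (b + j) (g + k) p =
      p.1 ^ i * p.2 ^ j * (1 - p.1 - p.2) ^ k * (p.1 ^ a * p.2 ^ b * (1 - p.1 - p.2) ^ g) := by
  rw [dirichletFun, Real.rpow_add_natCast hp.1.ne', Real.rpow_add_natCast hp.2.1.ne',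
    Real.rpow_add_natCast hp.2.2.ne']
  ring

lemma integrableOn_T1_monomial {a b g : ℝ} (ha : -1 < a) (hb : -1 < b) (hg : -1 < g)
    (i j k : ℕ) :
    IntegrableOn (fun p : ℝ × ℝ => p.1 ^ i * p.2 ^ j * (1 - p.1 - p.2) ^ k *
      (p.1 ^ a * p.2 ^ b * (1 - p.1 - p.2) ^ g)) T1 := by
  have hi : (0 : ℝ) ≤ i := by positivity
  have hj : (0 : ℝ) ≤ j := by positivity
  have hk : (0 : ℝ) ≤ k := by positivity
  refine ((integrable_indicator_iff measurableSet_T1).mp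
    (integrable_indicator_T1_dirichletFun (p := a + i) (q := b + j) (r := g + k)
      (by linarith) (by linarith) (by linarith))).congr_fun (fun p hp => ?_) measurableSet_T1
  exact dirichletFun_add_nat hp a b g i j k

lemma setIntegral_T1_monomial {a b g : ℝ} (ha : -1 < a) (hb : -1 < b) (hg : -1 < g)
    (i j k : ℕ) :
    ∫ p in T1, p.1 ^ i * p.2 ^ j * (1 - p.1 - p.2) ^ k *
        (p.1 ^ a * p.2 ^ b * (1 - p.1 - p.2) ^ g) =
      Real.Gamma (a + i + 1) * Real.Gamma (b + j + 1) * Real.Gamma (g + k + 1) /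
        Real.Gamma (a + b + g + i + j + k + 3) := by
  have hi : (0 : ℝ) ≤ i := by positivity
  have hj : (0 : ℝ) ≤ j := by positivity
  have hk : (0 : ℝ) ≤ k := by positivity
  rw [← setIntegral_congr_fun measurableSet_T1 fun p hp => dirichletFun_add_nat hp a b g i j k,
    setIntegral_T1_dirichletFun (by linarith) (by linarith) (by linarith)]
  congr 2
  ring

/-- Orthogonality to all polynomials of degree `< n` follows from vanishing of the moments. -/
lemma setIntegral_T1_jacobiR_mul_eq_zero {n : ℕ} (hn : 1 ≤ n) (c B : ℝ) (u W : ℝ × ℝ → ℝ)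
    (hint : ∀ k i j : ℕ, IntegrableOn (fun p => u p ^ k * (p.1 ^ i * p.2 ^ j) * W p) T1)
    (hzero : ∀ i j : ℕ, i + j < n → ∑ k ∈ range (n + 1), jacobiCoeff n c B k *
      ∫ p in T1, u p ^ k * (p.1 ^ i * p.2 ^ j) * W p = 0)
    {w : MvPolynomial (Fin 2) ℝ} (hw : w.totalDegree ≤ n - 1) :
    ∫ p in T1, jacobiR n c B (1 - 2 * u p) * evalP w p * W p = 0 := by
  have h : ∀ p : ℝ × ℝ, jacobiR n c B (1 - 2 * u p) * evalP w p * W p =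
      ∑ m ∈ w.support, ∑ k ∈ range (n + 1),
        (poch (c + 1) n / n.factorial * w.coeff m) * jacobiCoeff n c B k *
          (u p ^ k * (p.1 ^ m 0 * p.2 ^ m 1) * W p) := by
    intro p
    rw [jacobiR_one_sub_two_mul, evalP, MvPolynomial.eval_eq', Finset.mul_sum, Finset.sum_mul]
    refine Finset.sum_congr rfl fun m _ => ?_
    rw [Finset.mul_sum, Finset.sum_mul, Finset.sum_mul]
    refine Finset.sum_congr rfl fun k _ => ?_
    simp only [Fin.prod_univ_two, Matrix.cons_val_zero, Matrix.cons_val_one]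
    ring
  simp only [h]
  rw [integral_finsetSum _ fun m _ => integrable_finsetSum _ fun k _ =>
    (hint k (m 0) (m 1)).const_mul _]
  refine Finset.sum_eq_zero fun m hm => ?_
  rw [integral_finsetSum _ fun k _ => (hint k (m 0) (m 1)).const_mul _]
  have hdeg : m 0 + m 1 < n := by
    have h1 := (MvPolynomial.le_totalDegree hm).trans hw
    rw [Finsupp.sum_fintype _ _ fun _ => rfl, Fin.sum_univ_two] at h1
    omega
  simp only [integral_const_mul, mul_assoc]
  have h2 := hzero (m 0) (m 1) hdeg
  simp only [mul_assoc] at h2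
  simp only [← Finset.mul_sum]
  simp [h2]

/-- Let `α, β, γ > -1` and `n ≥ 1`.  Each of the bivariate polynomials
`(x,y) ↦ P_n^{(α,β+γ+1)}(1-2x)`, `(x,y) ↦ P_n^{(β,α+γ+1)}(1-2y)` and
`(x,y) ↦ P_n^{(γ,α+β+1)}(2(x+y)-1)` has degree at most `n` and is orthogonal to every
bivariate polynomial of total degree at most `n-1` in `L²(T₁, x^α y^β (1-x-y)^γ dx dy)`;
i.e. each lies in the orthocomplement of `P_{n-1}(T₁)` in `P_n(T₁)`. -/
theorem statement11 (a b g : ℝ) (ha : -1 < a) (hb : -1 < b) (hg : -1 < g)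
    (n : ℕ) (hn : 1 ≤ n) :
    (jacobiPoly n a (b + g + 1)).natDegree ≤ n ∧
    (jacobiPoly n b (a + g + 1)).natDegree ≤ n ∧
    (jacobiPoly n g (a + b + 1)).natDegree ≤ n ∧
    ∀ w : MvPolynomial (Fin 2) ℝ, w.totalDegree ≤ n - 1 →
      (∫ p in T1, jacobiR n a (b + g + 1) (1 - 2 * p.1) * evalP w p *
        (p.1 ^ a * p.2 ^ b * (1 - p.1 - p.2) ^ g)) = 0 ∧
      (∫ p in T1, jacobiR n b (a + g + 1) (1 - 2 * p.2) * evalP w p *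
        (p.1 ^ a * p.2 ^ b * (1 - p.1 - p.2) ^ g)) = 0 ∧
      (∫ p in T1, jacobiR n g (a + b + 1) (2 * (p.1 + p.2) - 1) * evalP w p *
        (p.1 ^ a * p.2 ^ b * (1 - p.1 - p.2) ^ g)) = 0 := by
  refine ⟨jacobiPoly_natDegree_le _ _ _, jacobiPoly_natDegree_le _ _ _,
    jacobiPoly_natDegree_le _ _ _, fun w hw => ⟨?_, ?_, ?_⟩⟩
  · have e : ∀ (k i j : ℕ) (p : ℝ × ℝ), p.1 ^ k * (p.1 ^ i * p.2 ^ j) =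
        p.1 ^ (k + i) * p.2 ^ j * (1 - p.1 - p.2) ^ 0 := fun k i j p => by ring
    refine setIntegral_T1_jacobiR_mul_eq_zero hn a (b + g + 1) (fun p => p.1)
      (fun p => p.1 ^ a * p.2 ^ b * (1 - p.1 - p.2) ^ g) (fun k i j => ?_) (fun i j hij => ?_) hw
    · simp only [e]
      exact integrableOn_T1_monomial ha hb hg _ _ _
    · simp only [e, setIntegral_T1_monomial ha hb hg]
      have h := sum_jacobiCoeff_mul_Gamma_div_Gamma (B := b + g + 1) ha (by linarith) hij
      rw [← mul_eq_zero_of_right (Real.Gamma (b + j + 1) * Real.Gamma (g + 1)) h, Finset.mul_sum]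
      refine Finset.sum_congr rfl fun k _ => ?_
      have e1 : a + ((k + i : ℕ) : ℝ) + 1 = a + 1 + k + i := by push_cast; ring
      have e2 : a + b + g + ((k + i : ℕ) : ℝ) + j + ((0 : ℕ) : ℝ) + 3 =
        a + (b + g + 1) + i + j + 2 + k := by push_cast; ring
      rw [e1, e2, Nat.cast_zero, add_zero]
      ring
  · have e : ∀ (k i j : ℕ) (p : ℝ × ℝ), p.2 ^ k * (p.1 ^ i * p.2 ^ j) =
        p.1 ^ i * p.2 ^ (k + j) * (1 - p.1 - p.2) ^ 0 := fun k i j p => by ring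
    refine setIntegral_T1_jacobiR_mul_eq_zero hn b (a + g + 1) (fun p => p.2)
      (fun p => p.1 ^ a * p.2 ^ b * (1 - p.1 - p.2) ^ g) (fun k i j => ?_) (fun i j hij => ?_) hw
    · simp only [e]
      exact integrableOn_T1_monomial ha hb hg _ _ _
    · simp only [e, setIntegral_T1_monomial ha hb hg]
      have h := sum_jacobiCoeff_mul_Gamma_div_Gamma (i := j) (l := i) (B := a + g + 1) hb
        (by linarith) (by omega : j + i < n)
      rw [← mul_eq_zero_of_right (Real.Gamma (a + i + 1) * Real.Gamma (g + 1)) h, Finset.mul_sum]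
      refine Finset.sum_congr rfl fun k _ => ?_
      have e1 : b + ((k + j : ℕ) : ℝ) + 1 = b + 1 + k + j := by push_cast; ring
      have e2 : a + b + g + i + ((k + j : ℕ) : ℝ) + ((0 : ℕ) : ℝ) + 3 =
        b + (a + g + 1) + j + i + 2 + k := by push_cast; ring
      rw [e1, e2, Nat.cast_zero, add_zero]
      ring
  · have e : ∀ (k i j : ℕ) (p : ℝ × ℝ), (1 - p.1 - p.2) ^ k * (p.1 ^ i * p.2 ^ j) =
        p.1 ^ i * p.2 ^ j * (1 - p.1 - p.2) ^ k := fun k i j p => by ring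
    have e0 : ∀ p : ℝ × ℝ, 2 * (p.1 + p.2) - 1 = 1 - 2 * (1 - p.1 - p.2) := fun p => by ring
    simp only [e0]
    refine setIntegral_T1_jacobiR_mul_eq_zero hn g (a + b + 1) (fun p => 1 - p.1 - p.2)
      (fun p => p.1 ^ a * p.2 ^ b * (1 - p.1 - p.2) ^ g) (fun k i j => ?_) (fun i j hij => ?_) hw
    · simp only [e]
      exact integrableOn_T1_monomial ha hb hg _ _ _
    · simp only [e, setIntegral_T1_monomial ha hb hg]
      have h := sum_jacobiCoeff_mul_Gamma_div_Gamma (i := 0) (l := i + j) (B := a + b + 1) hg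
        (by linarith) (by omega : 0 + (i + j) < n)
      rw [← mul_eq_zero_of_right (Real.Gamma (a + i + 1) * Real.Gamma (b + j + 1)) h,
        Finset.mul_sum]
      refine Finset.sum_congr rfl fun k _ => ?_
      have e1 : g + (k : ℝ) + 1 = g + 1 + k + ((0 : ℕ) : ℝ) := by push_cast; ring
      have e2 : a + b + g + i + j + k + 3 =
        g + (a + b + 1) + ((0 : ℕ) : ℝ) + ((i + j : ℕ) : ℝ) + 2 + k := by push_cast; ring
      rw [e1, e2]
      ring
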